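/- arXiv:2003.12586 — 9 statements merged into one kernel-verified Lean document; each statement's English description precedes it below -/
import Mathlib

section
/- For any field k, the ring k[T]_ℚ is an integral domain in which every finitely generated ideal is principal; that is, k[T]_ℚ is a Bézout domain. -/
open scoped NNRat

noncomputable def rootT (k : Type*) [Field k] (n : ℕ) : AddMonoidAlgebra k ℚ≥0 :=
  AddMonoidAlgebra.single ((n : ℚ≥0)⁻¹) 1

lemma rootT_pow (k : Type*) [Field k] (n m : ℕ) (hm : 0 < m) :
    rootT k (n * m) ^ m = rootT k n := by
  have : (m : ℚ≥0) ≠ 0 := by exact_mod_cast hm.ne'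
  unfold rootT
  rw [AddMonoidAlgebra.single_pow, one_pow]
  congr 1
  push_cast
  rw [nsmul_eq_mul, mul_inv, mul_comm, mul_assoc, inv_mul_cancel₀ this, mul_one]

lemma aeval_rootT_mul (k : Type*) [Field k] (n m : ℕ) (hm : 0 < m) (p : Polynomial k) :
    Polynomial.aeval (rootT k (n * m)) (Polynomial.expand k m p)
      = Polynomial.aeval (rootT k n) p := by
  rw [Polynomial.expand_aeval, rootT_pow k n m hm]

lemma exists_common (k : Type*) [Field k] (x y : AddMonoidAlgebra k ℚ≥0)
    (hx : ∃ n : ℕ, 0 < n ∧ ∃ p : Polynomial k, Polynomial.aeval (rootT k n) p = x)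
    (hy : ∃ n : ℕ, 0 < n ∧ ∃ p : Polynomial k, Polynomial.aeval (rootT k n) p = y) :
    ∃ n : ℕ, 0 < n ∧ ∃ p q : Polynomial k, Polynomial.aeval (rootT k n) p = x ∧
      Polynomial.aeval (rootT k n) q = y := by
  obtain ⟨n, hn, p, rfl⟩ := hx
  obtain ⟨m, hm, q, rfl⟩ := hy
  refine ⟨n * m, Nat.mul_pos hn hm, Polynomial.expand k m p, Polynomial.expand k n q,
    aeval_rootT_mul k n m hm p, ?_⟩
  rw [mul_comm n m]
  exact aeval_rootT_mul k m n hn q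

lemma exists_poly (k : Type*) [Field k] (x : AddMonoidAlgebra k ℚ≥0) :
    ∃ n : ℕ, 0 < n ∧ ∃ p : Polynomial k, Polynomial.aeval (rootT k n) p = x := by
  induction x using AddMonoidAlgebra.induction_linear with
  | zero => exact ⟨1, one_pos, 0, by simp⟩
  | add f g hf hg =>
    obtain ⟨n, hn, p, q, rfl, rfl⟩ := exists_common k f g hf hg
    exact ⟨n, hn, p + q, by simp⟩
  | single a b =>
    refine ⟨a.den, a.den_pos, Polynomial.monomial a.num b, ?_⟩
    rw [Polynomial.aeval_monomial, rootT, AddMonoidAlgebra.single_pow, one_pow,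
      AddMonoidAlgebra.coe_algebraMap, Function.comp_apply, AddMonoidAlgebra.single_mul_single]
    simp only [zero_add, mul_one, nsmul_eq_mul, Algebra.algebraMap_self, RingHom.id_apply]
    congr 1
    rw [← div_eq_mul_inv, NNRat.num_div_den]

/-- For any field `k`, the ring `k[T]_ℚ` is an integral domain in which every
finitely generated ideal is principal, i.e. a Bézout domain. -/
theorem stmt2 (k : Type*) [Field k] :
    IsDomain (AddMonoidAlgebra k ℚ≥0) ∧
    ∀ I : Ideal (AddMonoidAlgebra k ℚ≥0), I.FG → I.IsPrincipal := by
  refine ⟨inferInstance, ?_⟩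
  have h : IsBezout (AddMonoidAlgebra k ℚ≥0) := by
    rw [IsBezout.iff_span_pair_isPrincipal]
    intro x y
    obtain ⟨n, -, p, q, rfl, rfl⟩ :=
      exists_common k x y (exists_poly k x) (exists_poly k y)
    obtain ⟨g, hg⟩ := (inferInstance : (Ideal.span {p, q}).IsPrincipal)
    have := congrArg (Ideal.map (Polynomial.aeval (rootT k n) : Polynomial k →ₐ[k] _)) hg
    rw [Ideal.submodule_span_eq, Ideal.map_span, Ideal.map_span, Set.image_pair,
      Set.image_singleton] at this
    exact ⟨_, this⟩
  exact fun I hI => h.isPrincipal_of_FG I hI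
end

section
/- Let R be a Noetherian commutative ring and n ≥ 1. Then every finitely generated ideal of R[T_1,…,T_n]_ℚ is finitely presented as a module over R[T_1,…,T_n]_ℚ; that is, R[T_1,…,T_n]_ℚ is a coherent ring. -/
open scoped NNRat

theorem fp_map_of_flat {P A : Type*} [CommRing P] [CommRing A] [Algebra P A] [IsNoetherianRing P]
    [Module.Flat P A] (J : Ideal P) : Module.FinitePresentation A (J.map (algebraMap P A)) := by
  let l : J →ₗ[P] A := (Algebra.linearMap P A) ∘ₗ J.subtype
  have hfp : Module.FinitePresentation P J := Module.finitePresentation_of_finite P J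
  have hinj : Function.Injective (l.liftBaseChange A) := by
    have h1 := Module.Flat.lTensor_preserves_injective_linearMap (M := A) J.subtype
      J.injective_subtype
    have h2 : ∀ x, l.liftBaseChange A x = TensorProduct.rid P A (J.subtype.lTensor A x) := by
      intro x
      induction x using TensorProduct.induction_on with
      | zero => simp
      | add x y hx hy => simp only [map_add, hx, hy]
      | tmul a j => simp [l, Algebra.smul_def, mul_comm]
    intro x y hxy
    rw [h2, h2] at hxy
    exact h1 ((TensorProduct.rid P A).injective hxy)
  have hr : LinearMap.range (l.liftBaseChange A) = J.map (algebraMap P A) := by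
    rw [LinearMap.range_liftBaseChange, Ideal.map, Ideal.span]
    congr 1
    ext x
    simp [l]
  let e := LinearEquiv.ofInjective _ hinj
  have := Module.FinitePresentation.of_equiv e
  rw [← hr]
  exact this

theorem fp_map_of_flat' {P A : Type*} [CommRing P] [CommRing A] [IsNoetherianRing P]
    (φ : P →+* A) (hφ : φ.Flat) (I : Ideal A) (J : Ideal P) (h : J.map φ = I) :
    Module.FinitePresentation A I := by
  subst h
  algebraize [φ]
  exact fp_map_of_flat J

theorem flat_of_bij {R M G B : Type*} [CommRing R] [AddCommMonoid M] [AddCommMonoid G]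
    (f : M →+ G) (b : B → G) (hb : Function.Bijective (fun p : B × M => b p.1 + f p.2)) :
    (AddMonoidAlgebra.mapDomainRingHom R f).Flat := by
  algebraize [AddMonoidAlgebra.mapDomainRingHom R f]
  let L := Finsupp.linearCombination (AddMonoidAlgebra R M)
    (fun i : B => (AddMonoidAlgebra.single (b i) 1 : AddMonoidAlgebra R G))
  let e : (B →₀ AddMonoidAlgebra R M) ≃+ AddMonoidAlgebra R G :=
    (Finsupp.mapRange.addEquiv AddMonoidAlgebra.coeffAddEquiv).trans <|
    Finsupp.curryAddEquiv.symm.trans <|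
    (Finsupp.domCongr (Equiv.ofBijective _ hb)).trans AddMonoidAlgebra.coeffAddEquiv.symm
  have he : L.toAddMonoidHom = e.toAddMonoidHom := by
    ext i m r : 4
    simp [L, e, Algebra.smul_def, RingHom.algebraMap_toAlgebra,
      AddMonoidAlgebra.single_mul_single, add_comm]
  have hL : Function.Bijective L := by
    have : (L : _ → _) = e := by
      ext1 x; exact DFunLike.congr_fun he x
    rw [this]; exact e.bijective
  have := Module.Flat.of_linearEquiv (LinearEquiv.ofBijective L hL).symm
  exact this

noncomputable def scl (n N : ℕ) : (Fin n →₀ ℕ) →+ (Fin n →₀ ℚ≥0) :=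
  Finsupp.mapRange.addMonoidHom
    ((AddMonoidHom.mulRight ((N : ℚ≥0)⁻¹)).comp (Nat.castAddMonoidHom ℚ≥0))

theorem scl_apply (n N : ℕ) (m : Fin n →₀ ℕ) (i : Fin n) : scl n N m i = m i * (N : ℚ≥0)⁻¹ := rfl

theorem scl_bij (n N : ℕ) (hN : 0 < N) : Function.Bijective
    (fun p : {a : Fin n →₀ ℚ≥0 // ∀ i, a i * N < 1} × (Fin n →₀ ℕ) => p.1.1 + scl n N p.2) := by
  have hN' : (0 : ℚ≥0) < N := by exact_mod_cast hN
  constructor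
  · rintro ⟨⟨a, ha⟩, m⟩ ⟨⟨a', ha'⟩, m'⟩ h
    have key : ∀ i, a i * N + m i = a' i * N + m' i := by
      intro i
      have := congrArg (fun z => z * (N : ℚ≥0)) (DFunLike.congr_fun h i)
      simpa [scl_apply, add_mul, hN'.ne'] using this
    have hm : m = m' := by
      ext i
      have h1 := key i
      have h2 := congrArg Nat.floor h1
      rw [Nat.floor_add_natCast (by positivity), Nat.floor_add_natCast (by positivity),
        Nat.floor_eq_zero.2 (ha i), Nat.floor_eq_zero.2 (ha' i)] at h2
      simpa using h2
    subst hm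
    have : a = a' := by
      ext1 i
      have h1 := key i
      exact mul_right_cancel₀ hN'.ne' (add_right_cancel h1)
    subst this
    rfl
  · intro g
    let m : Fin n →₀ ℕ := Finsupp.equivFunOnFinite.symm fun i => ⌊g i * N⌋₊
    let a : Fin n →₀ ℚ≥0 := Finsupp.equivFunOnFinite.symm fun i => g i - ⌊g i * N⌋₊ * (N : ℚ≥0)⁻¹
    have hle : ∀ i, (⌊g i * N⌋₊ : ℚ≥0) * (N : ℚ≥0)⁻¹ ≤ g i := fun i => by
      rw [← div_eq_mul_inv, div_le_iff₀ hN']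
      exact Nat.floor_le (by positivity)
    have hag : ∀ i, a i + ⌊g i * N⌋₊ * (N : ℚ≥0)⁻¹ = g i := fun i => tsub_add_cancel_of_le (hle i)
    refine ⟨⟨⟨a, fun i => ?_⟩, m⟩, ?_⟩
    · have h1 := congrArg (fun z => z * (N : ℚ≥0)) (hag i)
      simp only [add_mul, mul_assoc, inv_mul_cancel₀ hN'.ne', mul_one] at h1
      have h2 := Nat.lt_floor_add_one (g i * N)
      refine lt_of_add_lt_add_left (a := (⌊g i * N⌋₊ : ℚ≥0)) ?_
      rw [add_comm, h1]
      exact h2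
    · ext1 i
      simpa [scl_apply, m] using hag i

theorem mem_range_scl (n : ℕ) (E : Finset (Fin n →₀ ℚ≥0)) :
    ∃ N : ℕ, 0 < N ∧ ∀ a ∈ E, a ∈ Set.range (scl n N) := by
  refine ⟨∏ a ∈ E, ∏ i, (a i).den, Finset.prod_pos fun a _ => Finset.prod_pos fun i _ =>
    (a i).den_pos, fun a ha => ?_⟩
  set N := ∏ a ∈ E, ∏ i, (a i).den with hN
  have hpos : 0 < N := Finset.prod_pos fun a _ => Finset.prod_pos fun i _ => (a i).den_pos
  have hdvd : ∀ i, (a i).den ∣ N := fun i =>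
    (Finset.dvd_prod_of_mem (fun i => (a i).den) (Finset.mem_univ i)).trans
      (Finset.dvd_prod_of_mem (fun a : Fin n →₀ ℚ≥0 => ∏ i, (a i).den) ha)
  choose c hc using hdvd
  refine ⟨Finsupp.equivFunOnFinite.symm fun i => (a i).num * c i, ?_⟩
  ext1 i
  have hN' : (N : ℚ≥0) ≠ 0 := by exact_mod_cast hpos.ne'
  rw [scl_apply, ← div_eq_mul_inv, div_eq_iff hN']
  rw [hc i, Nat.cast_mul, ← mul_assoc, NNRat.mul_den_eq_num]
  simp

/-- If `R` is a Noetherian commutative ring and `n ≥ 1`, then every finitely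
generated ideal of `R[T_1,…,T_n]_ℚ` is finitely presented as a module over
`R[T_1,…,T_n]_ℚ`; that is, `R[T_1,…,T_n]_ℚ` is a coherent ring. -/
theorem stmt4 (R : Type*) [CommRing R] [IsNoetherianRing R] (n : ℕ) (hn : 1 ≤ n)
    (I : Ideal (AddMonoidAlgebra R (Fin n →₀ ℚ≥0))) (hI : I.FG) :
    Module.FinitePresentation (AddMonoidAlgebra R (Fin n →₀ ℚ≥0)) I := by
  classical
  obtain ⟨s, rfl⟩ := hI
  obtain ⟨N, hN, hE⟩ := mem_range_scl n (s.biUnion fun x => x.coeff.support)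
  have hflat := flat_of_bij (R := R) (scl n N) _ (scl_bij n N hN)
  have hinj : Function.Injective (scl n N) := by
    intro m m' h
    have := (scl_bij n N hN).1 (a₁ := (⟨0, by simp⟩, m)) (a₂ := (⟨0, by simp⟩, m'))
      (by simpa using h)
    simpa using this
  let φ := AddMonoidAlgebra.mapDomainRingHom R (scl n N)
  have : IsNoetherianRing (AddMonoidAlgebra R (Fin n →₀ ℕ)) :=
    inferInstanceAs (IsNoetherianRing (MvPolynomial (Fin n) R))
  have hs : (s : Set (AddMonoidAlgebra R (Fin n →₀ ℚ≥0))) ⊆ Set.range φ := by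
    intro x hx
    refine ⟨AddMonoidAlgebra.comapDomain (scl n N) hinj x,
      AddMonoidAlgebra.mapDomain_comapDomain (fun a ha => ?_) hinj⟩
    exact hE a (Finset.mem_biUnion.2 ⟨x, hx, ha⟩)
  have hmap : (Ideal.span (φ ⁻¹' s)).map φ = Ideal.span (s : Set _) := by
    rw [Ideal.map_span, Set.image_preimage_eq_of_subset hs]
  exact fp_map_of_flat' φ hflat _ _ hmap
end

section
/- Let k be an uncountable algebraically closed field and n ≥ 1. For every maximal ideal 𝔪 of k[T_1,…,T_n]_ℚ, the composite ring homomorphism k → k[T_1,…,T_n]_ℚ → k[T_1,…,T_n]_ℚ/𝔪 is bijective; that is, the residue field at every maximal ideal is k itself. -/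
open scoped NNRat

/-- Over an uncountable algebraically closed field `k`, with `n ≥ 1`, for every
maximal ideal `𝔪` of `k[T_1,…,T_n]_ℚ` the composite `k → k[T_1,…,T_n]_ℚ → k[T_1,…,T_n]_ℚ/𝔪`
is bijective: the residue field at every maximal ideal is `k`. -/
theorem stmt6 (k : Type*) [Field k] [IsAlgClosed k] [Uncountable k]
    (n : ℕ) (hn : 1 ≤ n)
    (m : Ideal (AddMonoidAlgebra k (Fin n →₀ ℚ≥0))) (hm : m.IsMaximal) :
    Function.Bijective (algebraMap k (AddMonoidAlgebra k (Fin n →₀ ℚ≥0) ⧸ m)) := by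
  letI : Field (AddMonoidAlgebra k (Fin n →₀ ℚ≥0) ⧸ m) := Ideal.Quotient.field m
  have hrank : Module.rank k (AddMonoidAlgebra k (Fin n →₀ ℚ≥0) ⧸ m) ≤ Cardinal.aleph0 := by
    refine (LinearMap.rank_le_of_surjective (Ideal.Quotient.mkₐ k m).toLinearMap
      (Ideal.Quotient.mkₐ_surjective k m)).trans ?_
    rw [(AddMonoidAlgebra.coeffLinearEquiv k (S := k) (M := Fin n →₀ ℚ≥0)).rank_eq]
    rw [rank_finsupp_self]
    rw [Cardinal.lift_le_aleph0]
    exact Cardinal.mk_le_aleph0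
  have halg : Algebra.IsAlgebraic k (AddMonoidAlgebra k (Fin n →₀ ℚ≥0) ⧸ m) := by
    refine ⟨fun x => ?_⟩
    by_contra hx
    have h2 := (Transcendental.linearIndependent_sub_inv hx).cardinal_le_rank.trans hrank
    exact not_countable (α := k) (Cardinal.mk_le_aleph0_iff.mp h2)
  have : Algebra.IsIntegral k (AddMonoidAlgebra k (Fin n →₀ ℚ≥0) ⧸ m) :=
    Algebra.isAlgebraic_iff_isIntegral.mp halg
  exact IsAlgClosed.algebraMap_bijective_of_isIntegral
end

section
/- (Weak Nullstellensatz for rational-degree polynomials.) Let k be an uncountable algebraically closed field, n ≥ 1, and let I be a proper ideal of A := k[T_1,…,T_n]_ℚ. Then there exists a k-algebra homomorphism φ : A → k with I ⊆ ker φ; that is, the zero set V(I) is nonempty. -/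
open scoped NNRat

theorem exists_hom_of_rank_le (k : Type*) [Field k] [IsAlgClosed k] [Uncountable k]
    (L : Type*) [Field L] [Algebra k L] (hrank : Module.rank k L ≤ Cardinal.aleph0) :
    Nonempty (L →ₐ[k] k) := by
  have halg : Algebra.IsAlgebraic k L := by
    refine ⟨fun x => ?_⟩
    by_contra hx
    have h2 := (show Transcendental k x from hx).linearIndependent_sub_inv.cardinal_lift_le_rank
    have := h2.trans (Cardinal.lift_le.2 hrank)
    rw [Cardinal.lift_aleph0, Cardinal.lift_le_aleph0, Cardinal.mk_le_aleph0_iff] at this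
    exact not_countable this
  exact ⟨IsAlgClosed.lift⟩

/-- weak Nullstellensatz: over an uncountable algebraically closed field `k`,
with `n ≥ 1`, every proper ideal `I` of `k[T_1,…,T_n]_ℚ` has a nonempty zero set: there is a
`k`-algebra homomorphism `φ : k[T_1,…,T_n]_ℚ → k` with `I ⊆ ker φ`. -/
theorem stmt7 (k : Type*) [Field k] [IsAlgClosed k] [Uncountable k]
    (n : ℕ) (hn : 1 ≤ n)
    (I : Ideal (AddMonoidAlgebra k (Fin n →₀ ℚ≥0))) (hI : I ≠ ⊤) :
    ∃ φ : AddMonoidAlgebra k (Fin n →₀ ℚ≥0) →ₐ[k] k, I ≤ RingHom.ker φ := by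
  obtain ⟨M, hM, hIM⟩ := Ideal.exists_le_maximal I hI
  letI : Field (AddMonoidAlgebra k (Fin n →₀ ℚ≥0) ⧸ M) := Ideal.Quotient.field M
  have hspan : Submodule.span k (Set.range fun a : Fin n →₀ ℚ≥0 =>
      Ideal.Quotient.mkₐ k M (AddMonoidAlgebra.single a 1)) = ⊤ := by
    rw [eq_top_iff]
    rintro x -
    obtain ⟨f, rfl⟩ := Ideal.Quotient.mkₐ_surjective k M x
    induction f using AddMonoidAlgebra.induction_linear with
    | zero => simp
    | add f g hf hg => rw [map_add]; exact add_mem hf hg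
    | single a r =>
      have : (AddMonoidAlgebra.single a r : AddMonoidAlgebra k (Fin n →₀ ℚ≥0))
          = r • AddMonoidAlgebra.single a 1 := by simp
      rw [this, map_smul]
      exact Submodule.smul_mem _ _ (Submodule.subset_span ⟨a, rfl⟩)
  have hrank : Module.rank k (AddMonoidAlgebra k (Fin n →₀ ℚ≥0) ⧸ M) ≤ Cardinal.aleph0 := by
    rw [← rank_top, ← hspan]
    refine (rank_span_le _).trans ?_
    exact (Set.countable_range _).le_aleph0
  obtain ⟨ψ⟩ := exists_hom_of_rank_le k _ hrank
  refine ⟨ψ.comp (Ideal.Quotient.mkₐ k M), fun x hx => ?_⟩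
  have h0 : Ideal.Quotient.mkₐ k M x = 0 := Ideal.Quotient.eq_zero_iff_mem.2 (hIM hx)
  rw [RingHom.mem_ker, AlgHom.comp_apply, h0, map_zero]
end

section
/- (Strong Nullstellensatz for rational-degree polynomials.) Let k be an uncountable algebraically closed field, n ≥ 1, and let J be a finitely generated ideal of A := k[T_1,…,T_n]_ℚ. Then for every f ∈ A: f lies in the radical of J if and only if φ(f) = 0 for every k-algebra homomorphism φ : A → k with J ⊆ ker φ. In other words, I(V(J)) = √J. -/
open scoped NNRat

theorem aux_integral (k : Type*) [Field k] (n : ℕ) :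
    (MvPolynomial.aeval (R := k) (fun i : Fin n =>
      (AddMonoidAlgebra.single (Finsupp.single i (1 : ℚ≥0)) (1 : k) :
        AddMonoidAlgebra k (Fin n →₀ ℚ≥0)))).toRingHom.IsIntegral := by
  set g := (MvPolynomial.aeval (R := k) (fun i : Fin n =>
      (AddMonoidAlgebra.single (Finsupp.single i (1 : ℚ≥0)) (1 : k) :
        AddMonoidAlgebra k (Fin n →₀ ℚ≥0)))) with hg
  have key : ∀ a : Fin n →₀ ℚ≥0, g.toRingHom.IsIntegralElem
      (AddMonoidAlgebra.single a (1 : k)) := by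
    intro a
    induction a using Finsupp.induction_linear with
    | zero =>
      have := g.toRingHom.isIntegralElem_one
      rwa [AddMonoidAlgebra.one_def] at this
    | add a b ha hb =>
      have := RingHom.IsIntegralElem.mul _ ha hb
      rwa [AddMonoidAlgebra.single_mul_single, one_mul] at this
    | single i q =>
      let _ : Algebra (MvPolynomial (Fin n) k) (AddMonoidAlgebra k (Fin n →₀ ℚ≥0)) :=
        g.toRingHom.toAlgebra
      refine IsIntegral.of_pow (R := MvPolynomial (Fin n) k) q.den_pos ?_
      have h : (AddMonoidAlgebra.single (Finsupp.single i q) (1 : k) :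
        AddMonoidAlgebra k (Fin n →₀ ℚ≥0)) ^ q.den = g.toRingHom (MvPolynomial.X i ^ q.num) := by
        rw [map_pow]
        change _ = (g (MvPolynomial.X i)) ^ q.num
        rw [hg, MvPolynomial.aeval_X, AddMonoidAlgebra.single_pow, AddMonoidAlgebra.single_pow,
          one_pow, one_pow, Finsupp.smul_single, Finsupp.smul_single]
        congr 2
        simp [NNRat.den_mul_eq_num]
      rw [h]
      exact isIntegral_algebraMap
  intro x
  induction x using AddMonoidAlgebra.induction_on with
  | of m => exact key m
  | add x y hx hy => exact RingHom.IsIntegralElem.add _ hx hy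
  | smul r x hx =>
    have h := RingHom.IsIntegralElem.mul _ (g.toRingHom.isIntegralElem_map (x := MvPolynomial.C r)) hx
    have e : g.toRingHom (MvPolynomial.C r) = algebraMap k _ r := by
      change g (algebraMap k _ r) = _
      exact g.commutes r
    rwa [e, ← Algebra.smul_def] at h

/-- strong Nullstellensatz: over an uncountable algebraically closed field `k`,
with `n ≥ 1`, for a finitely generated ideal `J` of `A := k[T_1,…,T_n]_ℚ` and any `f ∈ A`,
`f ∈ √J` iff `φ(f) = 0` for every `k`-algebra homomorphism `φ : A → k` with `J ⊆ ker φ`. -/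
theorem stmt8 (k : Type*) [Field k] [IsAlgClosed k] [Uncountable k]
    (n : ℕ) (hn : 1 ≤ n)
    (J : Ideal (AddMonoidAlgebra k (Fin n →₀ ℚ≥0))) (hJ : J.FG)
    (f : AddMonoidAlgebra k (Fin n →₀ ℚ≥0)) :
    f ∈ J.radical ↔
      ∀ φ : AddMonoidAlgebra k (Fin n →₀ ℚ≥0) →ₐ[k] k, J ≤ RingHom.ker φ → φ f = 0 := by
  constructor
  · rintro ⟨m, hm⟩ φ hφ
    have := hφ hm
    rw [RingHom.mem_ker, map_pow] at this
    exact eq_zero_of_pow_eq_zero this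
  · intro H
    have hint := aux_integral k n
    set g := (MvPolynomial.aeval (R := k) (fun i : Fin n =>
      (AddMonoidAlgebra.single (Finsupp.single i (1 : ℚ≥0)) (1 : k) :
        AddMonoidAlgebra k (Fin n →₀ ℚ≥0)))) with hg
    have hjac : IsJacobsonRing (AddMonoidAlgebra k (Fin n →₀ ℚ≥0)) :=
      isJacobsonRing_of_isIntegral' _ hint
    rw [Ideal.radical_eq_jacobson, Ideal.jacobson, Ideal.mem_sInf]
    rintro m ⟨hJm, hm⟩
    have hQ : (m.comap g.toRingHom).IsMaximal :=
      Ideal.isMaximal_comap_of_isIntegral_of_isMaximal' _ hint m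
    have h1 := MvPolynomial.quotient_mk_comp_C_isIntegral_of_isJacobsonRing (m.comap g.toRingHom)
    have h2 : (Ideal.quotientMap m g.toRingHom le_rfl).IsIntegral := hint.quotient
    have h3 := RingHom.IsIntegral.trans _ _ h1 h2
    have e : (Ideal.quotientMap m g.toRingHom le_rfl).comp
        ((Ideal.Quotient.mk (m.comap g.toRingHom)).comp MvPolynomial.C) =
        algebraMap k (AddMonoidAlgebra k (Fin n →₀ ℚ≥0) ⧸ m) := by
      ext r
      change Ideal.Quotient.mk m (g (algebraMap k _ r)) = _
      rw [g.commutes]; rfl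
    rw [e] at h3
    have : Algebra.IsIntegral k (AddMonoidAlgebra k (Fin n →₀ ℚ≥0) ⧸ m) := ⟨h3⟩
    have hb := IsAlgClosed.algebraMap_bijective_of_isIntegral (k := k)
      (K := AddMonoidAlgebra k (Fin n →₀ ℚ≥0) ⧸ m)
    let E := AlgEquiv.ofBijective (Algebra.ofId k (AddMonoidAlgebra k (Fin n →₀ ℚ≥0) ⧸ m)) hb
    have h4 := H (E.symm.toAlgHom.comp (Ideal.Quotient.mkₐ k m)) (by
      intro x hx
      rw [RingHom.mem_ker]
      change E.symm (Ideal.Quotient.mk m x) = 0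
      rw [Ideal.Quotient.eq_zero_iff_mem.2 (hJm hx), map_zero])
    change E.symm (Ideal.Quotient.mk m f) = 0 at h4
    rw [EmbeddingLike.map_eq_zero_iff] at h4
    exact Ideal.Quotient.eq_zero_iff_mem.1 h4
end

section
/- (Noether normalization substitution lemma.) Let k be a field, n ≥ 1, and let g ∈ k[X_0,…,X_n] be a nonconstant multivariate polynomial with ordinary (natural number) exponents. Then there exist natural numbers e_0,…,e_{n−1}, a nonzero scalar a ∈ k, and an integer d > 0 such that the polynomial g(X_0 + X_n^{e_0}, X_1 + X_n^{e_1}, …, X_{n−1} + X_n^{e_{n−1}}, X_n), regarded as a polynomial in the single variable X_n with coefficients in k[X_0,…,X_{n−1}], has degree d and its leading coefficient is the constant polynomial a. -/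
theorem aux_inj {n : ℕ} (b : ℕ) (hb : 1 < b) (v w : Fin (n + 1) → ℕ)
    (hv : ∀ i, v i < b) (hw : ∀ i, w i < b)
    (h : ∑ i : Fin (n + 1), b ^ i.1 * v i = ∑ i : Fin (n + 1), b ^ i.1 * w i) : v = w := by
  apply List.ofFn_injective
  apply Nat.ofDigits_inj_of_len_eq hb (by simp)
  · intro l hl
    obtain ⟨i, rfl⟩ := (List.mem_ofFn' _ _).1 hl
    exact hv i
  · intro l hl
    obtain ⟨i, rfl⟩ := (List.mem_ofFn' _ _).1 hl
    exact hw i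
  · have h' : ∑ i : Fin (n + 1), v i * b ^ i.1 = ∑ i : Fin (n + 1), w i * b ^ i.1 := by
      simpa only [mul_comm (b ^ _)] using h
    simpa only [Nat.ofDigits_eq_sum_mapIdx, List.mapIdx_eq_ofFn, List.get_ofFn, List.length_ofFn,
      Fin.val_cast, List.sum_ofFn] using! h'

theorem aux_inj2 {n : ℕ} (b : ℕ) (hb : 1 < b) (v w : Fin (n + 1) → ℕ)
    (hv : ∀ i, v i < b) (hw : ∀ i, w i < b)
    (h : ∑ i : Fin n, v i.castSucc * b ^ (i.1 + 1) + v (Fin.last n) =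
      ∑ i : Fin n, w i.castSucc * b ^ (i.1 + 1) + w (Fin.last n)) : v = w := by
  have key := aux_inj b hb (Fin.cons (v (Fin.last n)) (fun i : Fin n => v i.castSucc) : Fin (n + 1) → ℕ)
    (Fin.cons (w (Fin.last n)) (fun i : Fin n => w i.castSucc))
    (by intro i; cases i using Fin.cases <;> simp [hv])
    (by intro i; cases i using Fin.cases <;> simp [hw])
    (by
      simp only [Fin.sum_univ_succ, Fin.cons_zero, Fin.cons_succ, Fin.val_zero, pow_zero, one_mul,
        Fin.val_succ]
      simp only [mul_comm (b ^ _)]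
      omega)
  funext j
  cases j using Fin.lastCases with
  | last => simpa using congrFun key 0
  | cast i => simpa using congrFun key i.succ

/-- Noether normalization substitution lemma: for a field `k`, `n ≥ 1` and a
nonconstant `g ∈ k[X_0,…,X_n]`, there are exponents `e_0,…,e_{n-1} : ℕ`, a scalar `a ≠ 0`
and `d > 0` such that `g(X_0 + X_n^{e_0}, …, X_{n-1} + X_n^{e_{n-1}}, X_n)`, viewed as a
polynomial in `X_n` over `k[X_0,…,X_{n-1}]`, has degree `d` and leading coefficient the
constant polynomial `a`. -/
theorem stmt9 (k : Type*) [Field k] (n : ℕ) (hn : 1 ≤ n)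
    (g : MvPolynomial (Fin (n + 1)) k) (hg : 0 < g.totalDegree) :
    ∃ (e : Fin n → ℕ) (a : k) (d : ℕ), a ≠ 0 ∧ 0 < d ∧
      (MvPolynomial.aeval
        (Fin.lastCases (Polynomial.X : Polynomial (MvPolynomial (Fin n) k))
          (fun i => Polynomial.C (MvPolynomial.X i) + Polynomial.X ^ e i)) g).natDegree = d ∧
      (MvPolynomial.aeval
        (Fin.lastCases (Polynomial.X : Polynomial (MvPolynomial (Fin n) k))
          (fun i => Polynomial.C (MvPolynomial.X i) + Polynomial.X ^ e i)) g).leadingCoeff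
        = MvPolynomial.C a := by
  classical
  set b := 2 + g.totalDegree with hb
  let e : Fin n → ℕ := fun i => b ^ (i.1 + 1)
  let F : Fin (n + 1) → Polynomial (MvPolynomial (Fin n) k) :=
    Fin.lastCases (Polynomial.X : Polynomial (MvPolynomial (Fin n) k))
          (fun i => Polynomial.C (MvPolynomial.X i) + Polynomial.X ^ e i)
  have he : ∀ i, e i ≠ 0 := fun i => pow_ne_zero _ (by omega)
  have hF1 : F (Fin.last n) = Polynomial.X := by simp [F]
  have hF2 : ∀ i : Fin n, F i.castSucc = Polynomial.X ^ e i + Polynomial.C (MvPolynomial.X i) := by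
    intro i; simp [F, add_comm]
  have hmon : ∀ j, (F j).Monic := by
    intro j
    cases j using Fin.lastCases with
    | last => rw [hF1]; exact Polynomial.monic_X
    | cast i => rw [hF2]; exact Polynomial.monic_X_pow_add_C _ (he i)
  let P : (Fin (n + 1) →₀ ℕ) → Polynomial (MvPolynomial (Fin n) k) := fun v => ∏ j, F j ^ v j
  let W : (Fin (n + 1) →₀ ℕ) → ℕ := fun v =>
    ∑ i : Fin n, v i.castSucc * b ^ (i.1 + 1) + v (Fin.last n)
  have hP : ∀ v, (P v).Monic := fun v =>
    Polynomial.monic_prod_of_monic _ _ (fun j _ => (hmon j).pow _)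
  have hPW : ∀ v, (P v).natDegree = W v := by
    intro v
    have : (P v).natDegree = ∑ j, v j * (F j).natDegree := by
      rw [Polynomial.natDegree_prod_of_monic _ _ (fun j _ => (hmon j).pow _)]
      exact Finset.sum_congr rfl (fun j _ => (hmon j).natDegree_pow _)
    rw [this, Fin.sum_univ_castSucc, hF1]
    simp only [hF2, Polynomial.natDegree_X_pow_add_C, Polynomial.natDegree_X, mul_one, W, e]
  have hsum : MvPolynomial.aeval F g =
      ∑ v ∈ g.support, Polynomial.C (MvPolynomial.C (g.coeff v)) * P v := by
    rw [MvPolynomial.aeval_def, MvPolynomial.eval₂_eq']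
    rfl
  have hg0 : g ≠ 0 := by
    rintro rfl
    simp at hg
  obtain ⟨v, hv, hmax⟩ := Finset.exists_max_image g.support W
    (MvPolynomial.support_nonempty.mpr hg0)
  have hlt : ∀ w ∈ g.support, ∀ i, w i < b := by
    intro w hw i
    have := (MvPolynomial.monomial_le_degreeOf i hw).trans (MvPolynomial.degreeOf_le_totalDegree g i)
    omega
  have hne : ∀ w ∈ g.support, w ≠ v → W w < W v := by
    intro w hw hwv
    refine lt_of_le_of_ne (hmax w hw) fun h => hwv ?_
    exact DFunLike.coe_injective (aux_inj2 b (by omega) w v (hlt w hw) (hlt v hv) h)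
  have hcv : g.coeff v ≠ 0 := MvPolynomial.mem_support_iff.mp hv
  have hcoeff : (MvPolynomial.aeval F g).coeff (W v) = MvPolynomial.C (g.coeff v) := by
    rw [hsum, Polynomial.finsetSum_coeff, Finset.sum_eq_single_of_mem v hv]
    · rw [Polynomial.coeff_C_mul, ← hPW, (hP v).coeff_natDegree, mul_one]
    · intro w hw hwv
      rw [Polynomial.coeff_C_mul, Polynomial.coeff_eq_zero_of_natDegree_lt, mul_zero]
      rw [hPW]; exact hne w hw hwv
  have hdeg : (MvPolynomial.aeval F g).natDegree = W v := by
    apply le_antisymm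
    · rw [hsum]
      refine Polynomial.natDegree_sum_le_of_forall_le _ _ fun w hw => ?_
      exact (Polynomial.natDegree_C_mul_le _ _).trans ((hPW w).le.trans (hmax w hw))
    · apply Polynomial.le_natDegree_of_ne_zero
      rw [hcoeff]
      simpa using hcv
  have hpos : 0 < W v := by
    by_contra h0
    have hz : ∀ w ∈ g.support, w = 0 := by
      intro w hw
      have hw0 : W w = 0 := by have := hmax w hw; omega
      have hbound : W w = W 0 := by rw [hw0]; simp [W]
      exact DFunLike.coe_injective
        (aux_inj2 b (by omega) w (0 : Fin (n + 1) →₀ ℕ) (hlt w hw) (by simp [hb]) hbound)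
    have : g.totalDegree = 0 := by
      rw [MvPolynomial.totalDegree_eq_zero_iff]
      intro w hw i
      simp [hz w hw]
    omega
  refine ⟨e, g.coeff v, W v, hcv, hpos, hdeg, ?_⟩
  change (MvPolynomial.aeval F g).leadingCoeff = _
  rw [Polynomial.leadingCoeff, hdeg, hcoeff]
end

section
/- Let k be an algebraically closed field and n ≥ 1. If f ∈ k[T_1,…,T_n]_ℚ satisfies φ(f) = 0 for every k-algebra homomorphism φ : k[T_1,…,T_n]_ℚ → k, then f = 0. (The ideal of functions vanishing on all of affine n-space is zero; equivalently k^n is irreducible.) -/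
open scoped NNRat

theorem stmt10_char (k : Type*) [Field k] [IsAlgClosed k] (d : ℚ) (hd : d ≠ 0) :
    ∃ g : ℚ →+ Additive kˣ, g d ≠ 0 := by
  have hsurj : ∀ {n : ℤ}, n ≠ 0 → Function.Surjective (fun a : kˣ => a ^ n) := by
    intro n hn x
    have key : ∀ y : kˣ, ∃ z : kˣ, z ^ n.natAbs = y := by
      intro y
      have hpos : 0 < n.natAbs := Int.natAbs_pos.mpr hn
      obtain ⟨z, hz⟩ := IsAlgClosed.exists_pow_nat_eq (y : k) hpos
      have hz0 : z ≠ 0 := by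
        rintro rfl
        rw [zero_pow hpos.ne'] at hz
        exact y.ne_zero hz.symm
      exact ⟨Units.mk0 z hz0, Units.ext (by simpa using hz)⟩
    rcases Int.natAbs_eq n with h | h
    · obtain ⟨z, hz⟩ := key x
      refine ⟨z, ?_⟩
      show z ^ n = x
      rw [h, zpow_natCast, hz]
    · obtain ⟨z, hz⟩ := key x⁻¹
      refine ⟨z, ?_⟩
      show z ^ n = x
      rw [h, zpow_neg, zpow_natCast, hz, inv_inv]
  letI : DivisibleBy (Additive kˣ) ℤ :=
    divisibleByOfSMulRightSurj _ _ (fun {n} hn x => hsurj hn x)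
  have hB : Module.Baer ℤ (Additive kˣ) := Module.Baer.of_divisible _
  classical
  obtain ⟨x, hx⟩ := Infinite.exists_notMem_finset ({0, 1} : Finset k)
  simp only [Finset.mem_insert, Finset.mem_singleton, not_or] at hx
  let t : Additive kˣ := Additive.ofMul (Units.mk0 x hx.1)
  have ht : t ≠ 0 := by
    intro h
    have h2 : Units.mk0 x hx.1 = 1 := h
    exact hx.2 (by simpa using congrArg Units.val h2)
  obtain ⟨g, hg⟩ := hB.extension_property (LinearMap.toSpanSingleton ℤ ℚ d)
    (by
      intro a b hab
      simpa [hd] using hab) (LinearMap.toSpanSingleton ℤ (Additive kˣ) t)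
  refine ⟨g.toAddMonoidHom, ?_⟩
  have h1 := LinearMap.congr_fun hg 1
  simp only [LinearMap.comp_apply, LinearMap.toSpanSingleton_apply, one_smul] at h1
  show g d ≠ 0
  rw [h1]
  exact ht

theorem stmt10_sep (k : Type*) [Field k] [IsAlgClosed k] (n : ℕ)
    (a b : Fin n →₀ ℚ≥0) (hab : a ≠ b) :
    ∃ χ : Multiplicative (Fin n →₀ ℚ≥0) →* k, χ (.ofAdd a) ≠ χ (.ofAdd b) := by
  obtain ⟨i, hi⟩ : ∃ i, a i ≠ b i := by
    by_contra! h
    exact hab (Finsupp.ext h)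
  obtain ⟨g, hg⟩ := stmt10_char k ((a i : ℚ) - (b i : ℚ))
    (by rw [sub_ne_zero]; exact_mod_cast hi)
  let G : (Fin n →₀ ℚ≥0) →+ Additive kˣ :=
    (g.comp (NNRat.coeHom : ℚ≥0 →+* ℚ).toAddMonoidHom).comp (Finsupp.applyAddHom i)
  refine ⟨(Units.coeHom k).comp (AddMonoidHom.toMultiplicativeLeft G), ?_⟩
  intro h
  have h2 : G a = G b := Units.ext h
  apply hg
  rw [map_sub, sub_eq_zero]
  exact h2

/-- Over an algebraically closed field `k`, with `n ≥ 1`, if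
`f ∈ k[T_1,…,T_n]_ℚ` is annihilated by every `k`-algebra homomorphism
`k[T_1,…,T_n]_ℚ → k`, then `f = 0`: the ideal of affine `n`-space is zero. -/
theorem stmt10 (k : Type*) [Field k] [IsAlgClosed k] (n : ℕ) (hn : 1 ≤ n)
    (f : AddMonoidAlgebra k (Fin n →₀ ℚ≥0))
    (h : ∀ φ : AddMonoidAlgebra k (Fin n →₀ ℚ≥0) →ₐ[k] k, φ f = 0) :
    f = 0 := by
  let ev : (Fin n →₀ ℚ≥0) → ((Multiplicative (Fin n →₀ ℚ≥0) →* k) →* k) := fun a =>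
    MonoidHom.eval (.ofAdd a)
  have hinj : Function.Injective ev := by
    intro a b hab
    by_contra hne
    obtain ⟨χ, hχ⟩ := stmt10_sep k n a b hne
    exact hχ (DFunLike.congr_fun hab χ)
  have hli := (linearIndependent_monoidHom (Multiplicative (Fin n →₀ ℚ≥0) →* k) k).comp ev hinj
  rw [linearIndependent_iff] at hli
  have h0 : f.coeff = 0 := by
    apply hli
    funext χ
    have := h (AddMonoidAlgebra.lift k k _ χ)
    rw [AddMonoidAlgebra.lift_apply] at this
    rw [Finsupp.linearCombination_apply, Finsupp.sum, Finset.sum_apply]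
    exact this
  ext a
  simp [h0]
end

section
/- Let p be a prime, k a perfect field of characteristic p, and n ≥ 1. Then the ring k[X_1,…,X_n]_{ℤ[1/p]} has characteristic p and its Frobenius endomorphism x ↦ x^p is bijective; that is, k[X_1,…,X_n]_{ℤ[1/p]} is a perfect ring of characteristic p. -/
open scoped NNRat

/-- The additive submonoid of `ℚ≥0` of rationals with `p`-power denominator. -/
def Mp (p : ℕ) : AddSubmonoid ℚ≥0 where
  carrier := {q : ℚ≥0 | ∃ m : ℕ, ∃ c : ℕ, (p : ℚ≥0) ^ m * q = (c : ℚ≥0)}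
  zero_mem' := ⟨0, 0, by simp⟩
  add_mem' := by
    rintro a b ⟨m, c, hc⟩ ⟨m', c', hc'⟩
    refine ⟨m + m', c * p ^ m' + c' * p ^ m, ?_⟩
    have h : (p : ℚ≥0) ^ (m + m') * (a + b)
        = ((p : ℚ≥0) ^ m * a) * (p : ℚ≥0) ^ m' + ((p : ℚ≥0) ^ m' * b) * (p : ℚ≥0) ^ m := by
      ring
    rw [h, hc, hc']
    push_cast
    ring

lemma Mp_div (p : ℕ) (hp : p.Prime) (a : Mp p) : ∃ b : Mp p, p • b = a := by
  have h0 : (p : ℚ≥0) ≠ 0 := by exact_mod_cast hp.ne_zero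
  obtain ⟨q, m, c, hc⟩ := a
  refine ⟨⟨q / p, m + 1, c, ?_⟩, ?_⟩
  · rw [← hc, pow_succ]
    field_simp
  · ext1
    simp only [AddSubmonoidClass.coe_nsmul, nsmul_eq_mul]
    field_simp

/-- For a prime `p`, a perfect field `k` of characteristic `p` and `n ≥ 1`,
the ring `k[X_1,…,X_n]_{ℤ[1/p]}` has characteristic `p` and its Frobenius `x ↦ x^p` is
bijective; i.e. it is a perfect ring of characteristic `p`. -/
theorem stmt11 (p : ℕ) (hp : p.Prime) (k : Type*) [Field k] [ExpChar k p]
    [PerfectRing k p] (n : ℕ) (hn : 1 ≤ n) :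
    CharP (AddMonoidAlgebra k (Fin n →₀ Mp p)) p ∧
    Function.Bijective (fun x : AddMonoidAlgebra k (Fin n →₀ Mp p) => x ^ p) := by
  have : Fact p.Prime := ⟨hp⟩
  have : CharP k p := by
    cases ‹ExpChar k p› with
    | zero => exact absurd hp Nat.not_prime_one
    | prime _ => assumption
  have hc : CharP (AddMonoidAlgebra k (Fin n →₀ Mp p)) p :=
    charP_of_injective_algebraMap
      (algebraMap k (AddMonoidAlgebra k (Fin n →₀ Mp p))).injective p
  refine ⟨hc, ?_, ?_⟩
  · exact frobenius_inj (AddMonoidAlgebra k (Fin n →₀ Mp p)) p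
  · choose f hf using Mp_div p hp
    have hf0 : f 0 = 0 := by
      have := hf 0
      simpa [hp.ne_zero] using congrArg Subtype.val this
    intro x
    induction x using AddMonoidAlgebra.induction_linear with
    | zero => exact ⟨0, zero_pow hp.ne_zero⟩
    | add x y hx hy =>
      obtain ⟨a, rfl⟩ := hx
      obtain ⟨b, rfl⟩ := hy
      exact ⟨a + b, add_pow_char _ _ p⟩
    | single g r =>
      obtain ⟨s, rfl⟩ := surjective_frobenius k p r
      refine ⟨AddMonoidAlgebra.single (g.mapRange f hf0) s, ?_⟩
      have : p • g.mapRange f hf0 = g := by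
        ext1 i
        simp [hf]
      simp only [AddMonoidAlgebra.single_pow, this, frobenius_def]
end

section
/- Let k be an uncountable algebraically closed field and let B be a field equipped with a k-algebra structure such that the dimension of B as a k-vector space is at most countable. Then the structure map k → B is bijective; that is, B = k. -/
open scoped Cardinal

/-- If `k` is an uncountable algebraically closed field and `B` is a field
that is a `k`-algebra of at most countable dimension as a `k`-vector space, then the
structure map `k → B` is bijective, i.e. `B = k`. -/
theorem stmt18 (k B : Type*) [Field k] [IsAlgClosed k] [Uncountable k]
    [Field B] [Algebra k B] (h : Module.rank k B ≤ ℵ₀) :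
    Function.Bijective (algebraMap k B) := by
  have hA : Algebra.IsAlgebraic k B := by
    refine ⟨fun x => ?_⟩
    by_contra hx
    have hx : Transcendental k x := hx
    have h2 := hx.linearIndependent_sub_inv.cardinal_lift_le_rank
    have h3 := h2.trans (Cardinal.lift_le.2 h)
    rw [Cardinal.lift_aleph0, Cardinal.lift_le_aleph0, Cardinal.mk_le_aleph0_iff] at h3
    exact not_countable (α := k) h3
  have := Algebra.IsAlgebraic.isIntegral (K := k) (A := B)
  exact IsAlgClosed.algebraMap_bijective_of_isIntegral
end
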